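/- arXiv:2602.03386 — 9 statements merged into one kernel-verified Lean document; each statement's English description precedes it below -/
import Mathlib

section
/- Let S and A be finite nonempty sets, let d and d' be probability mass functions on S, and for each s ∈ S let π(·; s) and π'(·; s) be probability mass functions on A. Define probability mass functions on S × A by ν(s,a) := d(s)π(a; s) and ν'(s,a) := d'(s)π'(a; s). Then TV(ν, ν') ≤ TV(d, d') + sup_{s∈S} TV(π(·; s), π'(·; s)). -/
/-- Marginal decomposition of total variation: for probability mass
functions `ν(s,a) = d s * π s a` and `ν'(s,a) = d' s * π' s a` on `S × A`,
`TV(ν, ν') ≤ TV(d, d') + sup_{s} TV(π(·;s), π'(·;s))`,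
where `TV(P,Q) = (1/2) * ∑ x, |P x - Q x|`. -/
theorem tv_marginal_decomposition {S A : Type*} [Fintype S] [Fintype A]
    [Nonempty S] [Nonempty A]
    (d d' : S → ℝ) (π π' : S → A → ℝ)
    (hd0 : ∀ s, 0 ≤ d s) (hd1 : ∑ s, d s = 1)
    (hd'0 : ∀ s, 0 ≤ d' s) (hd'1 : ∑ s, d' s = 1)
    (hπ0 : ∀ s a, 0 ≤ π s a) (hπ1 : ∀ s, ∑ a, π s a = 1)
    (hπ'0 : ∀ s a, 0 ≤ π' s a) (hπ'1 : ∀ s, ∑ a, π' s a = 1) :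
    (1 / 2) * ∑ q : S × A, |d q.1 * π q.1 q.2 - d' q.1 * π' q.1 q.2|
      ≤ (1 / 2) * ∑ s, |d s - d' s|
        + ⨆ s : S, (1 / 2) * ∑ a, |π s a - π' s a| := by
  have hpointwise : ∀ s a, |d s * π s a - d' s * π' s a|
      ≤ |d s - d' s| * π s a + d' s * |π s a - π' s a| := fun s a => by
    calc |d s * π s a - d' s * π' s a|
        = |(d s - d' s) * π s a + d' s * (π s a - π' s a)| := by ring_nf
      _ ≤ |(d s - d' s) * π s a| + |d' s * (π s a - π' s a)| := abs_add_le _ _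
      _ = _ := by rw [abs_mul, abs_mul, abs_of_nonneg (hπ0 s a), abs_of_nonneg (hd'0 s)]
  have hsup : ∀ s, (1 / 2) * ∑ a, |π s a - π' s a|
      ≤ ⨆ s : S, (1 / 2) * ∑ a, |π s a - π' s a| :=
    le_ciSup (Set.finite_range fun s : S => (1 / 2) * ∑ a, |π s a - π' s a|).bddAbove
  calc (1 / 2) * ∑ q : S × A, |d q.1 * π q.1 q.2 - d' q.1 * π' q.1 q.2|
      = (1 / 2) * ∑ s, ∑ a, |d s * π s a - d' s * π' s a| := by
        rw [Fintype.sum_prod_type]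
    _ ≤ (1 / 2) * ∑ s, ∑ a, (|d s - d' s| * π s a + d' s * |π s a - π' s a|) := by
        gcongr with s _ a _
        exact hpointwise s a
    _ = (1 / 2) * ∑ s, |d s - d' s| + ∑ s, d' s * ((1 / 2) * ∑ a, |π s a - π' s a|) := by
        simp only [Finset.sum_add_distrib, ← Finset.mul_sum, hπ1, mul_one, mul_add,
          mul_left_comm (d' _)]
    _ ≤ (1 / 2) * ∑ s, |d s - d' s|
        + ∑ s, d' s * ⨆ s : S, (1 / 2) * ∑ a, |π s a - π' s a| := by
        gcongr with s _
        · exact hd'0 s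
        · exact hsup s
    _ = _ := by rw [← Finset.sum_mul, hd'1, one_mul]
end

section
/- Let π and π' be two policies (with the same initial distribution μ and transition kernel p). Then for every t ∈ {1, …, T}, TV(d_t^{π'}, d_t^π) ≤ Σ_{i=0}^{t−1} Σ_{s∈S} d_i^π(s) · TV(π'(·; s), π(·; s)). -/
/-- State marginals: `stateMarginal p μ π 0 = μ` and
`stateMarginal p μ π (t+1) s = ∑ s', stateMarginal p μ π t s' * ∑ a, π s' a * p s' a s`. -/
noncomputable def stateMarginal {S A : Type*} [Fintype S] [Fintype A]
    (p : S → A → S → ℝ) (μ : S → ℝ) (π : S → A → ℝ) : ℕ → S → ℝ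
  | 0 => μ
  | t + 1 => fun s => ∑ s', stateMarginal p μ π t s' * ∑ a, π s' a * p s' a s

/-- A stochastic kernel does not increase the `ℓ¹` norm of a signed weight. -/
theorem sum_abs_sum_mul_kernel_le {S A : Type*} [Fintype S] [Fintype A]
    {p : S → A → S → ℝ} (hp0 : ∀ s a s', 0 ≤ p s a s') (hp1 : ∀ s a, ∑ s', p s a s' = 1)
    (f : S → A → ℝ) :
    ∑ s, |∑ s', ∑ a, f s' a * p s' a s| ≤ ∑ s', ∑ a, |f s' a| := by
  calc ∑ s, |∑ s', ∑ a, f s' a * p s' a s|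
      ≤ ∑ s, ∑ s', ∑ a, |f s' a| * p s' a s := by
        gcongr with s
        refine (Finset.abs_sum_le_sum_abs _ _).trans (Finset.sum_le_sum fun s' _ => ?_)
        refine (Finset.abs_sum_le_sum_abs _ _).trans (Finset.sum_le_sum fun a _ => ?_)
        rw [abs_mul, abs_of_nonneg (hp0 s' a s)]
    _ = ∑ s', ∑ a, |f s' a| := by
        rw [Finset.sum_comm]
        refine Finset.sum_congr rfl fun s' _ => ?_
        rw [Finset.sum_comm]
        refine Finset.sum_congr rfl fun a _ => ?_
        rw [← Finset.mul_sum, hp1, mul_one]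

theorem stateMarginal_nonneg {S A : Type*} [Fintype S] [Fintype A]
    {p : S → A → S → ℝ} (hp0 : ∀ s a s', 0 ≤ p s a s') {μ : S → ℝ} (hμ0 : ∀ s, 0 ≤ μ s)
    {π : S → A → ℝ} (hπ0 : ∀ s a, 0 ≤ π s a) (t : ℕ) (s : S) :
    0 ≤ stateMarginal p μ π t s := by
  induction t generalizing s with
  | zero => exact hμ0 s
  | succ t ih =>
    exact Finset.sum_nonneg fun s' _ => mul_nonneg (ih s') <|
      Finset.sum_nonneg fun a _ => mul_nonneg (hπ0 s' a) (hp0 s' a s)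

theorem sum_abs_stateMarginal_succ_sub_le {S A : Type*} [Fintype S] [Fintype A]
    {p : S → A → S → ℝ} (hp0 : ∀ s a s', 0 ≤ p s a s') (hp1 : ∀ s a, ∑ s', p s a s' = 1)
    {μ : S → ℝ} (hμ0 : ∀ s, 0 ≤ μ s) {π π' : S → A → ℝ} (hπ0 : ∀ s a, 0 ≤ π s a)
    (hπ'0 : ∀ s a, 0 ≤ π' s a) (hπ'1 : ∀ s, ∑ a, π' s a = 1) (t : ℕ) :
    ∑ s, |stateMarginal p μ π' (t + 1) s - stateMarginal p μ π (t + 1) s|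
      ≤ ∑ s, |stateMarginal p μ π' t s - stateMarginal p μ π t s|
        + ∑ s, stateMarginal p μ π t s * ∑ a, |π' s a - π s a| := by
  set d := stateMarginal p μ π t with hd
  set d' := stateMarginal p μ π' t with hd'
  calc ∑ s, |stateMarginal p μ π' (t + 1) s - stateMarginal p μ π (t + 1) s|
      = ∑ s, |∑ s', ∑ a, (d' s' * π' s' a - d s' * π s' a) * p s' a s| := by
        simp only [stateMarginal, ← hd, ← hd', ← Finset.sum_sub_distrib, Finset.mul_sum,
          sub_mul, mul_assoc]
    _ ≤ ∑ s, ∑ a, |d' s * π' s a - d s * π s a| := sum_abs_sum_mul_kernel_le hp0 hp1 _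
    _ ≤ ∑ s, ∑ a, (|d' s - d s| * π' s a + d s * |π' s a - π s a|) := by
        gcongr with s _ a
        have hds : 0 ≤ d s := stateMarginal_nonneg hp0 hμ0 hπ0 t s
        calc |d' s * π' s a - d s * π s a|
            = |(d' s - d s) * π' s a + d s * (π' s a - π s a)| := by ring_nf
          _ ≤ |(d' s - d s) * π' s a| + |d s * (π' s a - π s a)| := abs_add_le _ _
          _ = |d' s - d s| * π' s a + d s * |π' s a - π s a| := by
            rw [abs_mul, abs_mul, abs_of_nonneg (hπ'0 s a), abs_of_nonneg hds]
    _ = ∑ s, |d' s - d s| + ∑ s, d s * ∑ a, |π' s a - π s a| := by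
        simp only [Finset.sum_add_distrib, ← Finset.mul_sum, hπ'1, mul_one]

/-- For policies `π, π'` with the same initial distribution and transition
kernel, and any `t ∈ {1,…,T}`,
`TV(d_t^{π'}, d_t^π) ≤ ∑_{i=0}^{t-1} ∑_s d_i^π(s) * TV(π'(·;s), π(·;s))`,
where `TV(P,Q) = (1/2) * ∑ x, |P x - Q x|`. -/
theorem marginal_tv_decomposition {S A : Type*} [Fintype S] [Fintype A]
    [Nonempty S] [Nonempty A]
    (T : ℕ) (hT : 1 ≤ T)
    (p : S → A → S → ℝ) (hp0 : ∀ s a s', 0 ≤ p s a s') (hp1 : ∀ s a, ∑ s', p s a s' = 1)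
    (μ : S → ℝ) (hμ0 : ∀ s, 0 ≤ μ s) (hμ1 : ∑ s, μ s = 1)
    (π π' : S → A → ℝ)
    (hπ0 : ∀ s a, 0 ≤ π s a) (hπ1 : ∀ s, ∑ a, π s a = 1)
    (hπ'0 : ∀ s a, 0 ≤ π' s a) (hπ'1 : ∀ s, ∑ a, π' s a = 1)
    (t : ℕ) (ht1 : 1 ≤ t) (htT : t ≤ T) :
    (1 / 2) * ∑ s, |stateMarginal p μ π' t s - stateMarginal p μ π t s|
      ≤ ∑ i ∈ Finset.range t, ∑ s,
          stateMarginal p μ π i s * ((1 / 2) * ∑ a, |π' s a - π s a|) := by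
  clear ht1 htT
  induction t with
  | zero => simp [stateMarginal]
  | succ t ih =>
    have hstep := sum_abs_stateMarginal_succ_sub_le hp0 hp1 hμ0 hπ0 hπ'0 hπ'1 t
    have hhalf : ∑ s, stateMarginal p μ π t s * ((1 / 2) * ∑ a, |π' s a - π s a|)
        = (1 / 2) * ∑ s, stateMarginal p μ π t s * ∑ a, |π' s a - π s a| := by
      rw [Finset.mul_sum]
      exact Finset.sum_congr rfl fun s _ => mul_left_comm _ _ _
    rw [Finset.sum_range_succ, hhalf]
    linarith
end

section
/- Let π_old and π be policies, let t ∈ {0, …, T−1}, let s ∈ S, and let 𝔸_max ≥ 0 satisfy |𝔸_t^{π_old}(s,a)| ≤ 𝔸_max for all a ∈ A. Then |Σ_{a∈A} π(a; s) · 𝔸_t^{π_old}(s,a)| ≤ 2 · TV(π(·; s), π_old(·; s)) · 𝔸_max. -/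
/-- Value with `n` steps remaining:
`valAux γ r p π (n+1) s = ∑ a, π s a * (r s a + γ * ∑ s', p s a s' * valAux γ r p π n s')`. -/
noncomputable def valAux {S A : Type*} [Fintype S] [Fintype A]
    (γ : ℝ) (r : S → A → ℝ) (p : S → A → S → ℝ) (π : S → A → ℝ) : ℕ → S → ℝ
  | 0 => fun _ => 0
  | n + 1 => fun s => ∑ a, π s a * (r s a + γ * ∑ s', p s a s' * valAux γ r p π n s')

/-- Finite-horizon value function `V_t^π` with horizon `T`: `V_T^π = 0` and the
backward Bellman recursion for `t < T`. -/
noncomputable def Vval {S A : Type*} [Fintype S] [Fintype A]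
    (γ : ℝ) (r : S → A → ℝ) (p : S → A → S → ℝ) (π : S → A → ℝ)
    (T t : ℕ) (s : S) : ℝ :=
  valAux γ r p π (T - t) s

/-- Finite-horizon state-action value `Q_t^π(s,a) = r(s,a) + γ ∑_{s'} p(s';s,a) V_{t+1}^π(s')`. -/
noncomputable def Qval {S A : Type*} [Fintype S] [Fintype A]
    (γ : ℝ) (r : S → A → ℝ) (p : S → A → S → ℝ) (π : S → A → ℝ)
    (T t : ℕ) (s : S) (a : A) : ℝ :=
  r s a + γ * ∑ s', p s a s' * Vval γ r p π T (t + 1) s'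

/-- Advantage `𝔸_t^π(s,a) = Q_t^π(s,a) - V_t^π(s)`. -/
noncomputable def Adv {S A : Type*} [Fintype S] [Fintype A]
    (γ : ℝ) (r : S → A → ℝ) (p : S → A → S → ℝ) (π : S → A → ℝ)
    (T t : ℕ) (s : S) (a : A) : ℝ :=
  Qval γ r p π T t s a - Vval γ r p π T t s

/-- The value function satisfies `V_t^π(s) = ∑ a, π(a;s) Q_t^π(s,a)` before the horizon. -/
theorem Vval_eq_sum_Qval {S A : Type*} [Fintype S] [Fintype A]
    (γ : ℝ) (r : S → A → ℝ) (p : S → A → S → ℝ) (π : S → A → ℝ)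
    {T t : ℕ} (ht : t < T) (s : S) :
    Vval γ r p π T t s = ∑ a, π s a * Qval γ r p π T t s a := by
  have h : T - t = (T - (t + 1)) + 1 := by omega
  simp only [Vval, Qval, h, valAux]

/-- The advantage of a policy averages to zero under that policy. -/
theorem sum_mul_Adv_self {S A : Type*} [Fintype S] [Fintype A]
    (γ : ℝ) (r : S → A → ℝ) (p : S → A → S → ℝ) (π : S → A → ℝ)
    {T t : ℕ} (ht : t < T) (s : S) (hπ : ∑ a, π s a = 1) :
    ∑ a, π s a * Adv γ r p π T t s a = 0 := by
  simp only [Adv, mul_sub, Finset.sum_sub_distrib, ← Finset.sum_mul, hπ, one_mul,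
    ← Vval_eq_sum_Qval γ r p π ht s, sub_self]

/-- If `|𝔸_t^{π_old}(s,a)| ≤ Amax` for all `a`, then
`|∑ a, π(a;s) 𝔸_t^{π_old}(s,a)| ≤ 2 * TV(π(·;s), π_old(·;s)) * Amax`. -/
theorem advantage_tv_bound {S A : Type*} [Fintype S] [Fintype A]
    [Nonempty S] [Nonempty A]
    (γ : ℝ) (hγ0 : 0 < γ) (hγ1 : γ < 1)
    (T : ℕ) (hT : 1 ≤ T)
    (Rs : ℝ) (r : S → A → ℝ) (hr : ∀ s a, |r s a| ≤ Rs)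
    (p : S → A → S → ℝ) (hp0 : ∀ s a s', 0 ≤ p s a s') (hp1 : ∀ s a, ∑ s', p s a s' = 1)
    (μ : S → ℝ) (hμ0 : ∀ s, 0 ≤ μ s) (hμ1 : ∑ s, μ s = 1)
    (πold π : S → A → ℝ)
    (hπold0 : ∀ s a, 0 ≤ πold s a) (hπold1 : ∀ s, ∑ a, πold s a = 1)
    (hπ0 : ∀ s a, 0 ≤ π s a) (hπ1 : ∀ s, ∑ a, π s a = 1)
    (t : ℕ) (ht : t < T) (s : S)
    (Amax : ℝ) (hAmax : 0 ≤ Amax)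
    (hbd : ∀ a, |Adv γ r p πold T t s a| ≤ Amax) :
    |∑ a, π s a * Adv γ r p πold T t s a|
      ≤ 2 * ((1 / 2) * ∑ a, |π s a - πold s a|) * Amax := by
  have hzero := sum_mul_Adv_self γ r p πold ht s (hπold1 s)
  calc |∑ a, π s a * Adv γ r p πold T t s a|
      = |∑ a, (π s a - πold s a) * Adv γ r p πold T t s a| := by
        simp only [sub_mul, Finset.sum_sub_distrib, hzero, sub_zero]
    _ ≤ ∑ a, |(π s a - πold s a) * Adv γ r p πold T t s a| := Finset.abs_sum_le_sum_abs _ _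
    _ ≤ ∑ a, |π s a - πold s a| * Amax := by
        gcongr with a
        rw [abs_mul]
        gcongr
        exact hbd a
    _ = 2 * ((1 / 2) * ∑ a, |π s a - πold s a|) * Amax := by
        rw [← Finset.sum_mul]
        ring
end

section
/- Let π̃ and π be two policies (with the same initial distribution μ, transition kernel p, reward r, discount γ and horizon T). Then Σ_s μ(s) V_0^{π̃}(s) − Σ_s μ(s) V_0^{π}(s) = Σ_{t=0}^{T−1} γ^t Σ_s d_t^{π̃}(s) Σ_a π̃(a; s) · 𝔸_t^{π}(s,a). -/
/-- One step of the state marginal recursion, tested against a function of the state. -/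
theorem sum_stateMarginal_succ_mul {S A : Type*} [Fintype S] [Fintype A]
    (p : S → A → S → ℝ) (μ : S → ℝ) (π : S → A → ℝ) (t : ℕ) (f : S → ℝ) :
    ∑ s, stateMarginal p μ π (t + 1) s * f s
      = ∑ s, stateMarginal p μ π t s * ∑ a, π s a * ∑ s', p s a s' * f s' := by
  simp only [stateMarginal, Finset.sum_mul, Finset.mul_sum]
  rw [Finset.sum_comm]
  refine Finset.sum_congr rfl fun s _ => ?_
  rw [Finset.sum_comm]
  refine Finset.sum_congr rfl fun a _ => Finset.sum_congr rfl fun s' _ => ?_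
  ring

/-- The gap between two value functions at time `t` is the expected advantage plus the discounted
expected gap at time `t + 1`. -/
theorem Vval_sub_Vval {S A : Type*} [Fintype S] [Fintype A]
    (γ : ℝ) (r : S → A → ℝ) (p : S → A → S → ℝ) (πt π : S → A → ℝ)
    (hπt1 : ∀ s, ∑ a, πt s a = 1) {T t : ℕ} (ht : t < T) (s : S) :
    Vval γ r p πt T t s - Vval γ r p π T t s
      = ∑ a, πt s a * Adv γ r p π T t s a
        + γ * ∑ a, πt s a * ∑ s', p s a s' *
            (Vval γ r p πt T (t + 1) s' - Vval γ r p π T (t + 1) s') := by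
  have hAdv : ∑ a, πt s a * Adv γ r p π T t s a
      = ∑ a, πt s a * Qval γ r p π T t s a - Vval γ r p π T t s := by
    simp only [Adv, mul_sub, Finset.sum_sub_distrib, ← Finset.sum_mul, hπt1, one_mul]
  have hQ : ∑ a, πt s a * Qval γ r p πt T t s a
      = ∑ a, πt s a * Qval γ r p π T t s a
        + γ * ∑ a, πt s a * ∑ s', p s a s' *
            (Vval γ r p πt T (t + 1) s' - Vval γ r p π T (t + 1) s') := by
    rw [Finset.mul_sum, ← Finset.sum_add_distrib]
    refine Finset.sum_congr rfl fun a _ => ?_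
    simp only [Qval, mul_sub, Finset.sum_sub_distrib]
    ring
  rw [hAdv, Vval_eq_sum_Qval γ r p πt ht, hQ]
  ring

/-- **performance difference identity.** For policies `π̃` and `π`,
`∑_s μ(s) V_0^{π̃}(s) - ∑_s μ(s) V_0^{π}(s)
  = ∑_{t=0}^{T-1} γ^t ∑_s d_t^{π̃}(s) ∑_a π̃(a;s) 𝔸_t^π(s,a)`. -/
theorem performance_difference {S A : Type*} [Fintype S] [Fintype A]
    [Nonempty S] [Nonempty A]
    (γ : ℝ) (hγ0 : 0 < γ) (hγ1 : γ < 1)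
    (T : ℕ) (hT : 1 ≤ T)
    (Rs : ℝ) (r : S → A → ℝ) (hr : ∀ s a, |r s a| ≤ Rs)
    (p : S → A → S → ℝ) (hp0 : ∀ s a s', 0 ≤ p s a s') (hp1 : ∀ s a, ∑ s', p s a s' = 1)
    (μ : S → ℝ) (hμ0 : ∀ s, 0 ≤ μ s) (hμ1 : ∑ s, μ s = 1)
    (πt π : S → A → ℝ)
    (hπt0 : ∀ s a, 0 ≤ πt s a) (hπt1 : ∀ s, ∑ a, πt s a = 1)
    (hπ0 : ∀ s a, 0 ≤ π s a) (hπ1 : ∀ s, ∑ a, π s a = 1) :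
    ∑ s, μ s * Vval γ r p πt T 0 s - ∑ s, μ s * Vval γ r p π T 0 s
      = ∑ t ∈ Finset.range T, γ ^ t *
          ∑ s, stateMarginal p μ πt t s * ∑ a, πt s a * Adv γ r p π T t s a := by
  have step : ∀ t ∈ Finset.range T,
      γ ^ t * ∑ s, stateMarginal p μ πt t s * ∑ a, πt s a * Adv γ r p π T t s a
        = γ ^ t * ∑ s, stateMarginal p μ πt t s *
            (Vval γ r p πt T t s - Vval γ r p π T t s)
          - γ ^ (t + 1) * ∑ s, stateMarginal p μ πt (t + 1) s *
            (Vval γ r p πt T (t + 1) s - Vval γ r p π T (t + 1) s) := by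
    intro t ht
    simp only [Vval_sub_Vval γ r p πt π hπt1 (Finset.mem_range.mp ht)]
    rw [sum_stateMarginal_succ_mul]
    simp only [mul_add, Finset.sum_add_distrib, mul_left_comm _ γ, ← Finset.mul_sum]
    ring
  rw [Finset.sum_congr rfl step, Finset.sum_range_sub']
  simp [stateMarginal, Vval, valAux, mul_sub]
end

section
/- Let θ ↦ π_θ be a parametrized policy family whose score function is bounded with constant Π_*. Then for every t ∈ {0, …, T}, every s ∈ S and all θ, θ' ∈ ℝ^d, |V_t^{π_θ}(s) − V_t^{π_{θ'}}(s)| ≤ ((1 − (T−t+1)γ^{T−t} + (T−t)γ^{T−t+1})/(1−γ)²) · Π_* · R_* · ‖θ − θ'‖. In particular, |J(θ) − J(θ')| ≤ ((1 − (T+1)γ^T + Tγ^{T+1})/(1−γ)²) · Π_* · R_* · ‖θ − θ'‖. -/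
/-- A weighted average of reals bounded by `M` is bounded by `M`. -/
lemma abs_weighted_sum_le {ι : Type*} [Fintype ι] {w f : ι → ℝ} {M : ℝ}
    (hw0 : ∀ i, 0 ≤ w i) (hw1 : ∑ i, w i = 1) (hf : ∀ i, |f i| ≤ M) :
    |∑ i, w i * f i| ≤ M := by
  calc |∑ i, w i * f i| ≤ ∑ i, |w i * f i| := Finset.abs_sum_le_sum_abs _ _
    _ ≤ ∑ i, w i * M := Finset.sum_le_sum fun i _ => by
        rw [abs_mul, abs_of_nonneg (hw0 i)]
        exact mul_le_mul_of_nonneg_left (hf i) (hw0 i)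
    _ = M := by rw [← Finset.sum_mul, hw1, one_mul]

/-- The expectation of a bounded function under a parametrized probability mass function with
bounded score is Lipschitz in the parameter. -/
lemma abs_weighted_sum_sub_le_of_score_bound {E ι : Type*} [NormedAddCommGroup E]
    [InnerProductSpace ℝ E] [CompleteSpace E] [Fintype ι] {w : E → ι → ℝ} {K M : ℝ}
    (hw1 : ∀ x, ∑ i, w x i = 1) (hdiff : ∀ i, Differentiable ℝ fun x => w x i)
    (hscore : ∀ x i, ‖gradient (fun y => w y i) x‖ ≤ K * w x i)
    {q : ι → ℝ} (hM : 0 ≤ M) (hq : ∀ i, |q i| ≤ M) (x y : E) :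
    |∑ i, w x i * q i - ∑ i, w y i * q i| ≤ K * M * ‖x - y‖ := by
  have hderiv (z : E) : HasFDerivAt (fun z => ∑ i, w z i * q i)
      (∑ i, q i • fderiv ℝ (fun y => w y i) z) z :=
    HasFDerivAt.fun_sum fun i _ => (hdiff i z).hasFDerivAt.mul_const (q i)
  have hbound (z : E) : ‖∑ i, q i • fderiv ℝ (fun y => w y i) z‖ ≤ K * M := by
    calc ‖∑ i, q i • fderiv ℝ (fun y => w y i) z‖
        ≤ ∑ i, ‖q i • fderiv ℝ (fun y => w y i) z‖ := norm_sum_le _ _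
      _ ≤ ∑ i, M * (K * w z i) := Finset.sum_le_sum fun i _ => by
          have h := hscore z i
          rw [gradient, LinearIsometryEquiv.norm_map] at h
          rw [norm_smul, Real.norm_eq_abs]
          exact mul_le_mul (hq i) h (norm_nonneg _) hM
      _ = K * M := by
          rw [← Finset.mul_sum, ← Finset.mul_sum, hw1, mul_one, mul_comm]
  exact convex_univ.norm_image_sub_le_of_norm_hasFDerivWithin_le
    (fun z _ => (hderiv z).hasFDerivWithinAt) (fun z _ => hbound z)
    (Set.mem_univ y) (Set.mem_univ x)

lemma abs_add_mul_weighted_sum_le {ι : Type*} [Fintype ι] {w f : ι → ℝ} {γ c R B : ℝ}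
    (hγ : 0 ≤ γ) (hw0 : ∀ i, 0 ≤ w i) (hw1 : ∑ i, w i = 1)
    (hc : |c| ≤ R) (hf : ∀ i, |f i| ≤ B) :
    |c + γ * ∑ i, w i * f i| ≤ R + γ * B := by
  refine (abs_add_le _ _).trans (add_le_add hc ?_)
  rw [abs_mul, abs_of_nonneg hγ]
  exact mul_le_mul_of_nonneg_left (abs_weighted_sum_le hw0 hw1 hf) hγ

lemma abs_valAux_le {S A : Type*} [Fintype S] [Fintype A] {γ R : ℝ} (hγ : 0 ≤ γ)
    {r : S → A → ℝ} (hr : ∀ s a, |r s a| ≤ R)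
    {p : S → A → S → ℝ} (hp0 : ∀ s a s', 0 ≤ p s a s') (hp1 : ∀ s a, ∑ s', p s a s' = 1)
    {π : S → A → ℝ} (hπ0 : ∀ s a, 0 ≤ π s a) (hπ1 : ∀ s, ∑ a, π s a = 1) (n : ℕ) (s : S) :
    |valAux γ r p π n s| ≤ R * ∑ k ∈ Finset.range n, γ ^ k := by
  induction n generalizing s with
  | zero => simp [valAux]
  | succ n ih =>
    have h : R * ∑ k ∈ Finset.range (n + 1), γ ^ k
        = R + γ * (R * ∑ k ∈ Finset.range n, γ ^ k) := by
      rw [geom_sum_succ]; ring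
    rw [h, valAux]
    exact abs_weighted_sum_le (hπ0 s) (hπ1 s) fun a =>
      abs_add_mul_weighted_sum_le hγ (hp0 s a) (hp1 s a) (hr s a) ih

lemma sum_range_succ_mul_pow {γ : ℝ} (hγ : γ ≠ 1) (n : ℕ) :
    ∑ k ∈ Finset.range n, ((k : ℝ) + 1) * γ ^ k
      = (1 - ((n : ℝ) + 1) * γ ^ n + (n : ℝ) * γ ^ (n + 1)) / (1 - γ) ^ 2 := by
  have h : 1 - γ ≠ 0 := sub_ne_zero.mpr hγ.symm
  rw [eq_div_iff (pow_ne_zero 2 h)]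
  induction n with
  | zero => simp
  | succ n ih =>
    rw [Finset.sum_range_succ, add_mul, ih]
    push_cast
    ring

lemma sum_range_succ_mul_pow_succ (γ : ℝ) (n : ℕ) :
    ∑ k ∈ Finset.range (n + 1), ((k : ℝ) + 1) * γ ^ k
      = ∑ k ∈ Finset.range (n + 1), γ ^ k
        + γ * ∑ k ∈ Finset.range n, ((k : ℝ) + 1) * γ ^ k := by
  simp only [add_mul, one_mul, Finset.sum_add_distrib]
  rw [Finset.sum_range_succ' (fun k : ℕ => (k : ℝ) * γ ^ k), ← Finset.sum_add_distrib,
    Finset.mul_sum, add_comm]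
  simp only [Nat.cast_zero, zero_mul, add_zero, add_right_inj]
  refine Finset.sum_congr rfl fun k _ => ?_
  push_cast
  ring

lemma abs_valAux_sub_le {E S A : Type*} [NormedAddCommGroup E] [InnerProductSpace ℝ E]
    [CompleteSpace E] [Fintype S] [Fintype A] {γ R K : ℝ} (hγ : 0 ≤ γ) (hR : 0 ≤ R)
    {r : S → A → ℝ} (hr : ∀ s a, |r s a| ≤ R)
    {p : S → A → S → ℝ} (hp0 : ∀ s a s', 0 ≤ p s a s') (hp1 : ∀ s a, ∑ s', p s a s' = 1)
    {π : E → S → A → ℝ} (hπ0 : ∀ x s a, 0 ≤ π x s a) (hπ1 : ∀ x s, ∑ a, π x s a = 1)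
    (hdiff : ∀ s a, Differentiable ℝ fun x => π x s a)
    (hscore : ∀ x s a, ‖gradient (fun y => π y s a) x‖ ≤ K * π x s a)
    (x y : E) (n : ℕ) (s : S) :
    |valAux γ r p (π x) n s - valAux γ r p (π y) n s|
      ≤ (∑ k ∈ Finset.range n, ((k : ℝ) + 1) * γ ^ k) * K * R * ‖x - y‖ := by
  induction n generalizing s with
  | zero => simp [valAux]
  | succ n ih =>
    set Q : E → A → ℝ := fun z a => r s a + γ * ∑ s', p s a s' * valAux γ r p (π z) n s'
    have hQ (a : A) : |Q x a| ≤ R * ∑ k ∈ Finset.range (n + 1), γ ^ k := by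
      rw [geom_sum_succ, mul_add, mul_one, add_comm, mul_left_comm]
      exact abs_add_mul_weighted_sum_le hγ (hp0 s a) (hp1 s a) (hr s a)
        (abs_valAux_le hγ hr hp0 hp1 (hπ0 x) (hπ1 x) n)
    have hpolicy := abs_weighted_sum_sub_le_of_score_bound (fun z => hπ1 z s) (hdiff s)
      (fun z => hscore z s)
      (mul_nonneg hR (Finset.sum_nonneg fun k _ => pow_nonneg hγ k)) hQ x y
    have hvalue : |∑ a, π y s a * (Q x a - Q y a)|
        ≤ γ * ((∑ k ∈ Finset.range n, ((k : ℝ) + 1) * γ ^ k) * K * R * ‖x - y‖) := by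
      refine abs_weighted_sum_le (hπ0 y s) (hπ1 y s) fun a => ?_
      have h : Q x a - Q y a = γ * ∑ s', p s a s' *
          (valAux γ r p (π x) n s' - valAux γ r p (π y) n s') := by
        simp only [Q, mul_sub, Finset.sum_sub_distrib]
        ring
      rw [h, abs_mul, abs_of_nonneg hγ]
      exact mul_le_mul_of_nonneg_left (abs_weighted_sum_le (hp0 s a) (hp1 s a) ih) hγ
    have hsplit : valAux γ r p (π x) (n + 1) s - valAux γ r p (π y) (n + 1) s
        = (∑ a, π x s a * Q x a - ∑ a, π y s a * Q x a)
          + ∑ a, π y s a * (Q x a - Q y a) := by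
      simp only [valAux, mul_sub, Finset.sum_sub_distrib, Q]
      ring
    rw [hsplit, sum_range_succ_mul_pow_succ]
    refine (abs_add_le _ _).trans ((add_le_add hpolicy hvalue).trans_eq ?_)
    ring

/-- **Lipschitz continuity of the value function and of `J`.**
For a parametrized policy family with score function bounded by `Pis` (Π_*):
for every `t ∈ {0,…,T}`, every state `s` and all parameters `θ, θ'`,
`|V_t^{π_θ}(s) - V_t^{π_{θ'}}(s)|
  ≤ ((1 - (T-t+1)γ^{T-t} + (T-t)γ^{T-t+1})/(1-γ)²) * Π_* * R_* * ‖θ - θ'‖`,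
and in particular
`|J(θ) - J(θ')| ≤ ((1 - (T+1)γ^T + Tγ^{T+1})/(1-γ)²) * Π_* * R_* * ‖θ - θ'‖`. -/
theorem value_lipschitz_in_parameter {S A : Type*} [Fintype S] [Fintype A]
    [Nonempty S] [Nonempty A] {d : ℕ}
    (γ : ℝ) (hγ0 : 0 < γ) (hγ1 : γ < 1)
    (T : ℕ) (hT : 1 ≤ T)
    (Rs : ℝ) (r : S → A → ℝ) (hr : ∀ s a, |r s a| ≤ Rs)
    (p : S → A → S → ℝ) (hp0 : ∀ s a s', 0 ≤ p s a s') (hp1 : ∀ s a, ∑ s', p s a s' = 1)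
    (μ : S → ℝ) (hμ0 : ∀ s, 0 ≤ μ s) (hμ1 : ∑ s, μ s = 1)
    (π : EuclideanSpace ℝ (Fin d) → S → A → ℝ)
    (hπpos : ∀ θ s a, 0 < π θ s a)
    (hπ1 : ∀ θ s, ∑ a, π θ s a = 1)
    (hπdiff : ∀ s a, ContDiff ℝ 1 fun θ => π θ s a)
    (Pis : ℝ)
    (hscore : ∀ θ s a, ‖gradient (fun θ' => π θ' s a) θ‖ ≤ Pis * π θ s a)
    (θ θ' : EuclideanSpace ℝ (Fin d)) :
    (∀ t ≤ T, ∀ s : S,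
      |Vval γ r p (π θ) T t s - Vval γ r p (π θ') T t s|
        ≤ ((1 - (((T - t : ℕ) : ℝ) + 1) * γ ^ (T - t)
              + ((T - t : ℕ) : ℝ) * γ ^ (T - t + 1)) / (1 - γ) ^ 2)
            * Pis * Rs * ‖θ - θ'‖)
    ∧ |(∑ s, μ s * Vval γ r p (π θ) T 0 s) - ∑ s, μ s * Vval γ r p (π θ') T 0 s|
        ≤ ((1 - ((T : ℝ) + 1) * γ ^ T + (T : ℝ) * γ ^ (T + 1)) / (1 - γ) ^ 2)
            * Pis * Rs * ‖θ - θ'‖ := by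
  have hRs : 0 ≤ Rs := (abs_nonneg _).trans (hr (Classical.arbitrary S) (Classical.arbitrary A))
  have hval (n : ℕ) (s : S) := abs_valAux_sub_le hγ0.le hRs hr hp0 hp1
    (fun x s a => (hπpos x s a).le) hπ1 (fun s a => (hπdiff s a).differentiable one_ne_zero)
    hscore θ θ' n s
  simp only [sum_range_succ_mul_pow hγ1.ne] at hval
  refine ⟨fun t _ s => hval (T - t) s, ?_⟩
  rw [← Finset.sum_sub_distrib]
  simp only [← mul_sub]
  exact abs_weighted_sum_le hμ0 hμ1 (hval T)
end

section
/- Let θ ↦ π_θ be a parametrized policy family whose score function is bounded with constant Π_* and Lipschitz with constant L_s. Then J is differentiable and its gradient is L-Lipschitz: for all θ, θ' ∈ ℝ^d, ‖∇J(θ) − ∇J(θ')‖ ≤ L · ‖θ − θ'‖, where L := R_* · ( L_s(1−γ^T)/(1−γ)² − L_s T γ^T/(1−γ) + Π_*² · ( (1+γ−2γ^T)/(1−γ)³ − (2T−1)γ^T/(1−γ)² − T²γ^T/(1−γ) ) ). -/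
section

variable {ι E : Type*} [Fintype ι] [NormedAddCommGroup E] [NormedSpace ℝ E]

/-- A differentiable function bounded by `v`, with derivative bounded by `g` and `L`-Lipschitz. -/
structure SmoothBound (f : E → ℝ) (v g L : ℝ) : Prop where
  differentiable : Differentiable ℝ f
  abs_le : ∀ x, |f x| ≤ v
  norm_fderiv_le : ∀ x, ‖fderiv ℝ f x‖ ≤ g
  norm_fderiv_sub_le : ∀ x y, ‖fderiv ℝ f x - fderiv ℝ f y‖ ≤ L * ‖x - y‖

theorem norm_sum_smul_le_of_sum_eq_one {w : ι → ℝ} (hw0 : ∀ i, 0 ≤ w i) (hw1 : ∑ i, w i = 1)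
    {z : ι → E} {c : ℝ} (hz : ∀ i, ‖z i‖ ≤ c) : ‖∑ i, w i • z i‖ ≤ c := by
  calc ‖∑ i, w i • z i‖ ≤ ∑ i, w i * c := norm_sum_le_of_le _ fun i _ => by
        rw [norm_smul, Real.norm_of_nonneg (hw0 i)]
        exact mul_le_mul_of_nonneg_left (hz i) (hw0 i)
    _ = c := by rw [← Finset.sum_mul, hw1, one_mul]

theorem SmoothBound.abs_sub_le {f : E → ℝ} {v g L : ℝ} (hf : SmoothBound f v g L) (x y : E) :
    |f x - f y| ≤ g * ‖x - y‖ :=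
  convex_univ.norm_image_sub_le_of_norm_fderiv_le (fun z _ => hf.differentiable z)
    (fun z _ => hf.norm_fderiv_le z) (Set.mem_univ y) (Set.mem_univ x)

theorem SmoothBound.convexComb {w : ι → ℝ} (hw0 : ∀ i, 0 ≤ w i) (hw1 : ∑ i, w i = 1)
    {f : ι → E → ℝ} {v g L : ℝ} (hf : ∀ i, SmoothBound (f i) v g L) :
    SmoothBound (fun x => ∑ i, w i * f i x) v g L := by
  have hd : ∀ x, HasFDerivAt (fun x => ∑ i, w i * f i x) (∑ i, w i • fderiv ℝ (f i) x) x :=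
    fun x => HasFDerivAt.fun_sum fun i _ =>
      ((hf i).differentiable x).hasFDerivAt.const_mul (w i)
  refine ⟨fun x => (hd x).differentiableAt,
    fun x => norm_sum_smul_le_of_sum_eq_one (z := fun i => f i x) hw0 hw1
      fun i => (hf i).abs_le x, fun x => ?_,
    fun x y => ?_⟩
  · rw [(hd x).fderiv]
    exact norm_sum_smul_le_of_sum_eq_one hw0 hw1 fun i => (hf i).norm_fderiv_le x
  · rw [(hd x).fderiv, (hd y).fderiv, ← Finset.sum_sub_distrib]
    simp_rw [← smul_sub]
    exact norm_sum_smul_le_of_sum_eq_one hw0 hw1 fun i => (hf i).norm_fderiv_sub_le x y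

theorem SmoothBound.const_add_mul {f : E → ℝ} {v g L : ℝ} (hf : SmoothBound f v g L)
    {b R γ : ℝ} (hb : |b| ≤ R) (hγ : 0 ≤ γ) :
    SmoothBound (fun x => b + γ * f x) (R + γ * v) (γ * g) (γ * L) := by
  have hd : ∀ x, HasFDerivAt (fun x => b + γ * f x) (γ • fderiv ℝ f x) x :=
    fun x => ((hf.differentiable x).hasFDerivAt.const_mul γ).const_add b
  refine ⟨fun x => (hd x).differentiableAt, fun x => ?_, fun x => ?_, fun x y => ?_⟩
  · refine (abs_add_le _ _).trans (add_le_add hb ?_)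
    rw [abs_mul, abs_of_nonneg hγ]
    exact mul_le_mul_of_nonneg_left (hf.abs_le x) hγ
  · rw [(hd x).fderiv, norm_smul, Real.norm_of_nonneg hγ]
    exact mul_le_mul_of_nonneg_left (hf.norm_fderiv_le x) hγ
  · rw [(hd x).fderiv, (hd y).fderiv, ← smul_sub, norm_smul, Real.norm_of_nonneg hγ, mul_assoc]
    exact mul_le_mul_of_nonneg_left (hf.norm_fderiv_sub_le x y) hγ

theorem sum_abs_sub_le_of_norm_fderiv_le {w : ι → E → ℝ} (hw1 : ∀ x, ∑ i, w i x = 1)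
    (hwd : ∀ i, Differentiable ℝ (w i)) {P : ℝ}
    (hP : ∀ i x, ‖fderiv ℝ (w i) x‖ ≤ P * w i x) (x y : E) :
    ∑ i, |w i x - w i y| ≤ P * ‖x - y‖ := by
  let ε : ι → ℝ := fun i => SignType.sign (w i x - w i y)
  have hε : ∀ i, ‖ε i‖ ≤ 1 := fun i => by
    rcases lt_trichotomy (w i x - w i y) 0 with h | h | h <;> simp [ε, h]
  have hd : ∀ z, HasFDerivAt (fun z => ∑ i, ε i * w i z) (∑ i, ε i • fderiv ℝ (w i) z) z :=
    fun z => HasFDerivAt.fun_sum fun i _ => (hwd i z).hasFDerivAt.const_mul (ε i)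
  have hbound : ∀ z, ‖∑ i, ε i • fderiv ℝ (w i) z‖ ≤ P := fun z =>
    calc ‖∑ i, ε i • fderiv ℝ (w i) z‖ ≤ ∑ i, P * w i z := norm_sum_le_of_le _ fun i _ => by
          rw [norm_smul]
          exact (mul_le_of_le_one_left (norm_nonneg _) (hε i)).trans (hP i z)
      _ = P := by rw [← Finset.mul_sum, hw1, mul_one]
  have hmv := convex_univ.norm_image_sub_le_of_norm_hasFDerivWithin_le
    (fun z _ => (hd z).hasFDerivWithinAt) (fun z _ => hbound z)
    (Set.mem_univ y) (Set.mem_univ x)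
  rw [← Finset.sum_sub_distrib] at hmv
  simp_rw [← mul_sub, ε, sign_mul_self] at hmv
  exact (le_abs_self _).trans hmv

/-- Averaging functions against a smoothly varying probability vector with bounded Lipschitz
score. -/
theorem SmoothBound.mixture [Nonempty ι] {w : ι → E → ℝ} (hw0 : ∀ i x, 0 < w i x)
    (hw1 : ∀ x, ∑ i, w i x = 1) (hwd : ∀ i, Differentiable ℝ (w i)) {P K : ℝ}
    (hP : ∀ i x, ‖fderiv ℝ (w i) x‖ ≤ P * w i x)
    (hK : ∀ i x y, ‖(w i x)⁻¹ • fderiv ℝ (w i) x - (w i y)⁻¹ • fderiv ℝ (w i) y‖ ≤ K * ‖x - y‖)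
    {f : ι → E → ℝ} {v g L : ℝ} (hf : ∀ i, SmoothBound (f i) v g L) :
    SmoothBound (fun x => ∑ i, w i x * f i x) v (P * v + g)
      (P * (P * v + g) + K * v + P * g + L) := by
  let σ : ι → E → E →L[ℝ] ℝ := fun i x => (w i x)⁻¹ • fderiv ℝ (w i) x
  have hwσ : ∀ i x, w i x • σ i x = fderiv ℝ (w i) x := fun i x =>
    smul_inv_smul₀ (hw0 i x).ne' _
  have hσ : ∀ i x, ‖σ i x‖ ≤ P := fun i x => by
    rw [norm_smul, norm_inv, Real.norm_of_nonneg (hw0 i x).le, inv_mul_le_iff₀ (hw0 i x),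
      mul_comm]
    exact hP i x
  let z : ι → E → E →L[ℝ] ℝ := fun i x => f i x • σ i x + fderiv ℝ (f i) x
  obtain ⟨i₀⟩ := ‹Nonempty ι›
  have hP0 : 0 ≤ P := (norm_nonneg _).trans (hσ i₀ 0)
  have hz : ∀ i x, ‖z i x‖ ≤ P * v + g := fun i x => by
    refine (norm_add_le _ _).trans (add_le_add ?_ ((hf i).norm_fderiv_le x))
    rw [norm_smul, mul_comm]
    exact mul_le_mul (hσ i x) ((hf i).abs_le x) (norm_nonneg _) hP0
  have hd : ∀ x, HasFDerivAt (fun x => ∑ i, w i x * f i x) (∑ i, w i x • z i x) x := fun x => by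
    refine (HasFDerivAt.fun_sum fun i _ =>
      (hwd i x).hasFDerivAt.mul ((hf i).differentiable x).hasFDerivAt).congr_fderiv ?_
    refine Finset.sum_congr rfl fun i _ => ?_
    rw [← hwσ, smul_add, smul_comm (w i x) (f i x), add_comm]
  refine ⟨fun x => (hd x).differentiableAt, fun x =>
    norm_sum_smul_le_of_sum_eq_one (z := fun i => f i x) (fun i => (hw0 i x).le) (hw1 x)
      fun i => (hf i).abs_le x,
    fun x => ?_, fun x y => ?_⟩
  · rw [(hd x).fderiv]
    exact norm_sum_smul_le_of_sum_eq_one (fun i => (hw0 i x).le) (hw1 x) fun i => hz i x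
  have hsub : ∀ i, ‖z i x - z i y‖ ≤ (K * v + P * g + L) * ‖x - y‖ := fun i => by
    have hsplit : z i x - z i y = f i x • (σ i x - σ i y) + (f i x - f i y) • σ i y
        + (fderiv ℝ (f i) x - fderiv ℝ (f i) y) := by
      simp only [z]; module
    have h1 : ‖f i x • (σ i x - σ i y)‖ ≤ v * (K * ‖x - y‖) := by
      rw [norm_smul]
      exact mul_le_mul ((hf i).abs_le x) (hK i x y) (norm_nonneg _)
        ((abs_nonneg _).trans ((hf i).abs_le x))
    have h2 : ‖(f i x - f i y) • σ i y‖ ≤ (g * ‖x - y‖) * P := by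
      rw [norm_smul]
      exact mul_le_mul ((hf i).abs_sub_le x y) (hσ i y) (norm_nonneg _)
        ((abs_nonneg _).trans ((hf i).abs_sub_le x y))
    rw [hsplit]
    linarith [norm_add₃_le (a := f i x • (σ i x - σ i y)) (b := (f i x - f i y) • σ i y)
      (c := fderiv ℝ (f i) x - fderiv ℝ (f i) y), (hf i).norm_fderiv_sub_le x y]
  have hweights : ‖∑ i, (w i x - w i y) • z i x‖ ≤ P * ‖x - y‖ * (P * v + g) :=
    calc ‖∑ i, (w i x - w i y) • z i x‖ ≤ ∑ i, |w i x - w i y| * (P * v + g) :=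
          norm_sum_le_of_le _ fun i _ => by
            rw [norm_smul]
            exact mul_le_mul_of_nonneg_left (hz i x) (norm_nonneg _)
      _ = (∑ i, |w i x - w i y|) * (P * v + g) := by rw [Finset.sum_mul]
      _ ≤ _ := mul_le_mul_of_nonneg_right (sum_abs_sub_le_of_norm_fderiv_le hw1 hwd hP x y)
          ((norm_nonneg _).trans (hz i₀ x))
  have hsplit : ∑ i, w i x • z i x - ∑ i, w i y • z i y
      = ∑ i, (w i x - w i y) • z i x + ∑ i, w i y • (z i x - z i y) := by
    rw [← Finset.sum_sub_distrib, ← Finset.sum_add_distrib]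
    exact Finset.sum_congr rfl fun i _ => by module
  rw [(hd x).fderiv, (hd y).fderiv, hsplit]
  linarith [norm_add_le (∑ i, (w i x - w i y) • z i x) (∑ i, w i y • (z i x - z i y)),
    norm_sum_smul_le_of_sum_eq_one (fun i => (hw0 i y).le) (hw1 y) hsub]

end

theorem SmoothBound.valAux {S A E : Type*} [Fintype S] [Fintype A] [Nonempty A]
    [NormedAddCommGroup E] [NormedSpace ℝ E]
    {γ : ℝ} (hγ0 : 0 ≤ γ) (hγ1 : γ < 1) {R : ℝ} {r : S → A → ℝ} (hr : ∀ s a, |r s a| ≤ R)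
    {p : S → A → S → ℝ} (hp0 : ∀ s a s', 0 ≤ p s a s') (hp1 : ∀ s a, ∑ s', p s a s' = 1)
    {π : E → S → A → ℝ} (hπpos : ∀ θ s a, 0 < π θ s a) (hπ1 : ∀ θ s, ∑ a, π θ s a = 1)
    (hπd : ∀ s a, Differentiable ℝ fun θ => π θ s a) {P K : ℝ}
    (hP : ∀ θ s a, ‖fderiv ℝ (fun θ' => π θ' s a) θ‖ ≤ P * π θ s a)
    (hK : ∀ θ θ' s a, ‖(π θ s a)⁻¹ • fderiv ℝ (fun θ'' => π θ'' s a) θ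
      - (π θ' s a)⁻¹ • fderiv ℝ (fun θ'' => π θ'' s a) θ'‖ ≤ K * ‖θ - θ'‖) (n : ℕ) (s : S) :
    SmoothBound (fun θ => valAux γ r p (π θ) n s)
      (R * ((1 - γ ^ n) / (1 - γ)))
      (P * R * ((1 - γ ^ n) / (1 - γ) ^ 2 - n * γ ^ n / (1 - γ)))
      (R * (K * (1 - γ ^ n) / (1 - γ) ^ 2 - K * n * γ ^ n / (1 - γ)
        + P ^ 2 * ((1 + γ - 2 * γ ^ n) / (1 - γ) ^ 3
          - (2 * n - 1) * γ ^ n / (1 - γ) ^ 2 - n ^ 2 * γ ^ n / (1 - γ)))) := by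
  have hγ : 1 - γ ≠ 0 := (sub_pos.2 hγ1).ne'
  induction n generalizing s with
  | zero =>
    have hL : R * (K * (1 - γ ^ 0) / (1 - γ) ^ 2 - K * (0 : ℕ) * γ ^ 0 / (1 - γ)
        + P ^ 2 * ((1 + γ - 2 * γ ^ 0) / (1 - γ) ^ 3
          - (2 * (0 : ℕ) - 1) * γ ^ 0 / (1 - γ) ^ 2 - (0 : ℕ) ^ 2 * γ ^ 0 / (1 - γ))) = 0 := by
      simp only [pow_zero, Nat.cast_zero]
      field_simp
      ring
    rw [hL]
    constructor <;> simp [_root_.valAux]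
  | succ n ih =>
    have hstep := SmoothBound.mixture (fun a θ => hπpos θ s a) (fun θ => hπ1 θ s) (hπd s)
      (fun a θ => hP θ s a) (fun a θ θ' => hK θ θ' s a)
      fun a => (SmoothBound.convexComb (hp0 s a) (hp1 s a) ih).const_add_mul (hr s a) hγ0
    convert hstep using 1
    · rfl
    all_goals
      push_cast
      field_simp
      ring

/-- **L-smoothness of `J`.** Under a bounded (`Pis = Π_*`) and Lipschitz
(`Ls = L_s`) score function, `J(θ) = ∑_s μ(s) V_0^{π_θ}(s)` is differentiable with
`L`-Lipschitz gradient, where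
`L = R_*(L_s(1-γ^T)/(1-γ)² - L_s T γ^T/(1-γ)
     + Π_*²((1+γ-2γ^T)/(1-γ)³ - (2T-1)γ^T/(1-γ)² - T²γ^T/(1-γ)))`. -/
theorem J_L_smooth {S A : Type*} [Fintype S] [Fintype A]
    [Nonempty S] [Nonempty A] {d : ℕ}
    (γ : ℝ) (hγ0 : 0 < γ) (hγ1 : γ < 1)
    (T : ℕ) (hT : 1 ≤ T)
    (Rs : ℝ) (r : S → A → ℝ) (hr : ∀ s a, |r s a| ≤ Rs)
    (p : S → A → S → ℝ) (hp0 : ∀ s a s', 0 ≤ p s a s') (hp1 : ∀ s a, ∑ s', p s a s' = 1)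
    (μ : S → ℝ) (hμ0 : ∀ s, 0 ≤ μ s) (hμ1 : ∑ s, μ s = 1)
    (π : EuclideanSpace ℝ (Fin d) → S → A → ℝ)
    (hπpos : ∀ θ s a, 0 < π θ s a)
    (hπ1 : ∀ θ s, ∑ a, π θ s a = 1)
    (hπdiff : ∀ s a, ContDiff ℝ 1 fun θ => π θ s a)
    (Pis : ℝ)
    (hscore : ∀ θ s a, ‖gradient (fun θ' => π θ' s a) θ‖ ≤ Pis * π θ s a)
    (Ls : ℝ)
    (hscoreLip : ∀ θ θ' : EuclideanSpace ℝ (Fin d), ∀ (s : S) (a : A),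
      ‖(π θ s a)⁻¹ • gradient (fun θ'' => π θ'' s a) θ
          - (π θ' s a)⁻¹ • gradient (fun θ'' => π θ'' s a) θ'‖ ≤ Ls * ‖θ - θ'‖) :
    Differentiable ℝ (fun θ => ∑ s, μ s * Vval γ r p (π θ) T 0 s)
    ∧ ∀ θ θ' : EuclideanSpace ℝ (Fin d),
        ‖gradient (fun θ'' => ∑ s, μ s * Vval γ r p (π θ'') T 0 s) θ
          - gradient (fun θ'' => ∑ s, μ s * Vval γ r p (π θ'') T 0 s) θ'‖
        ≤ (Rs * (Ls * (1 - γ ^ T) / (1 - γ) ^ 2 - Ls * (T : ℝ) * γ ^ T / (1 - γ)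
            + Pis ^ 2 * ((1 + γ - 2 * γ ^ T) / (1 - γ) ^ 3
                - (2 * (T : ℝ) - 1) * γ ^ T / (1 - γ) ^ 2
                - (T : ℝ) ^ 2 * γ ^ T / (1 - γ)))) * ‖θ - θ'‖ := by
  let D := InnerProductSpace.toDual ℝ (EuclideanSpace ℝ (Fin d))
  have hJ := SmoothBound.convexComb hμ0 hμ1 <|
    SmoothBound.valAux hγ0.le hγ1 hr hp0 hp1 hπpos hπ1
      (fun s a => (hπdiff s a).differentiable one_ne_zero)
      (P := Pis) (K := Ls)
      (fun θ s a => by simpa [gradient] using hscore θ s a)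
      (fun θ θ' s a => by
        have h := hscoreLip θ θ' s a
        simp only [gradient] at h
        rw [← D.symm.norm_map]
        simpa [D] using h) T
  refine ⟨hJ.differentiable, fun θ θ' => ?_⟩
  rw [gradient, gradient, ← map_sub, LinearIsometryEquiv.norm_map]
  exact hJ.norm_fderiv_sub_le θ θ'
end

section
/- Let J : ℝ^d → ℝ be differentiable with L-Lipschitz gradient, let m ≥ 1 be a natural number, let 0 < η ≤ 1/(Lm), let θ ∈ ℝ^d, and let g_0, …, g_{m−1} ∈ ℝ^d. Set θ' := θ + η Σ_{k=0}^{m−1} g_k and ḡ := (1/m) Σ_{k=0}^{m−1} g_k. Then J(θ') ≥ J(θ) + (ηm/2)‖∇J(θ)‖² − (ηm/2)‖∇J(θ) − ḡ‖². -/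
/-- Quadratic lower bound for a real function whose gradient is `L`-Lipschitz. -/
theorem add_inner_gradient_sub_le_of_lipschitz_gradient {E : Type*} [NormedAddCommGroup E]
    [InnerProductSpace ℝ E] [CompleteSpace E] {f : E → ℝ} (hf : Differentiable ℝ f) {L : ℝ}
    (hLip : ∀ x y, ‖gradient f x - gradient f y‖ ≤ L * ‖x - y‖) (x v : E) :
    f x + inner ℝ (gradient f x) v - L / 2 * ‖v‖ ^ 2 ≤ f (x + v) := by
  let φ : ℝ → ℝ := fun t => f (x + t • v) - t * inner ℝ (gradient f x) v + L / 2 * ‖v‖ ^ 2 * t ^ 2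
  have hφ (t : ℝ) : HasDerivAt φ
      (inner ℝ (gradient f (x + t • v)) v - inner ℝ (gradient f x) v + L * ‖v‖ ^ 2 * t) t := by
    have hline : HasDerivAt (fun s : ℝ => x + s • v) v t := by
      simpa using ((hasDerivAt_id t).smul_const v).const_add x
    have hcomp : HasDerivAt (fun s : ℝ => f (x + s • v))
        (inner ℝ (gradient f (x + t • v)) v) t := by
      simpa [Function.comp_def] using
        (hf (x + t • v)).hasGradientAt.hasFDerivAt.comp_hasDerivAt t hline
    have hlin : HasDerivAt (fun s : ℝ => s * inner ℝ (gradient f x) v)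
        (inner ℝ (gradient f x) v) t := by
      simpa using (hasDerivAt_id t).mul_const (inner ℝ (gradient f x) v)
    have hquad := (hasDerivAt_pow 2 t).const_mul (L / 2 * ‖v‖ ^ 2)
    refine ((hcomp.sub hlin).add hquad).congr_deriv ?_
    push_cast
    ring
  have hmono : MonotoneOn φ (Set.Icc 0 1) := by
    refine monotoneOn_of_hasDerivWithinAt_nonneg (convex_Icc 0 1)
      (fun t _ => (hφ t).continuousAt.continuousWithinAt)
      (fun t _ => (hφ t).hasDerivWithinAt) fun t ht => ?_
    have ht0 : 0 ≤ t := (interior_subset ht).1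
    have hgrad := hLip (x + t • v) x
    rw [add_sub_cancel_left, norm_smul, Real.norm_of_nonneg ht0] at hgrad
    have hinner := neg_le_of_abs_le
      (abs_real_inner_le_norm (gradient f (x + t • v) - gradient f x) v)
    rw [inner_sub_left] at hinner
    nlinarith [mul_le_mul_of_nonneg_right hgrad (norm_nonneg v)]
  have h01 := hmono (Set.left_mem_Icc.2 zero_le_one) (Set.right_mem_Icc.2 zero_le_one) zero_le_one
  simp only [φ, zero_smul, one_smul, add_zero, zero_mul, one_mul] at h01
  linarith

/-- **per-epoch ascent property.** If `J` is differentiable with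
`L`-Lipschitz gradient, `m ≥ 1`, `0 < η ≤ 1/(Lm)`, then with
`θ' = θ + η ∑_{k<m} g_k` and `ḡ = (1/m) ∑_{k<m} g_k`,
`J(θ') ≥ J(θ) + (ηm/2)‖∇J(θ)‖² - (ηm/2)‖∇J(θ) - ḡ‖²`. -/
theorem per_epoch_ascent {d : ℕ} (J : EuclideanSpace ℝ (Fin d) → ℝ)
    (hJdiff : Differentiable ℝ J)
    (L : ℝ) (hL : 0 < L)
    (hLip : ∀ x y : EuclideanSpace ℝ (Fin d),
      ‖gradient J x - gradient J y‖ ≤ L * ‖x - y‖)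
    (m : ℕ) (hm : 1 ≤ m)
    (η : ℝ) (hη0 : 0 < η) (hη : η ≤ 1 / (L * (m : ℝ)))
    (θ : EuclideanSpace ℝ (Fin d)) (g : ℕ → EuclideanSpace ℝ (Fin d)) :
    J (θ + η • ∑ k ∈ Finset.range m, g k)
      ≥ J θ + (η * (m : ℝ) / 2) * ‖gradient J θ‖ ^ 2
        - (η * (m : ℝ) / 2) *
            ‖gradient J θ - ((m : ℝ))⁻¹ • ∑ k ∈ Finset.range m, g k‖ ^ 2 := by
  have hm0 : (0 : ℝ) < m := by exact_mod_cast hm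
  set S := ∑ k ∈ Finset.range m, g k
  have hdesc := add_inner_gradient_sub_le_of_lipschitz_gradient hJdiff hLip θ (η • S)
  rw [inner_smul_right, norm_smul, Real.norm_of_nonneg hη0.le] at hdesc
  rw [norm_sub_sq_real, inner_smul_right, norm_smul, Real.norm_of_nonneg (inv_nonneg.2 hm0.le)]
  have hstep : L * η ≤ (m : ℝ)⁻¹ := by
    rw [le_div_iff₀ (by positivity)] at hη
    rw [← one_div, le_div_iff₀ hm0]
    linarith
  have hquad : L * η * (η * ‖S‖ ^ 2) ≤ (m : ℝ)⁻¹ * (η * ‖S‖ ^ 2) := by gcongr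
  have hexpand : η * m / 2 * ‖gradient J θ‖ ^ 2 - η * m / 2 * (‖gradient J θ‖ ^ 2
      - 2 * ((m : ℝ)⁻¹ * inner ℝ (gradient J θ) S) + ((m : ℝ)⁻¹ * ‖S‖) ^ 2)
      = η * inner ℝ (gradient J θ) S - (m : ℝ)⁻¹ * (η * ‖S‖ ^ 2) / 2 := by
    field_simp
    ring
  linarith
end

section
/- Let θ ↦ π_θ be a parametrized policy family whose score function is bounded with constant Π_* and Lipschitz with constant L_s, let ε > 0, and let A_* ≥ 0. For t ∈ {0,…,T−1}, s ∈ S, a ∈ A, θ_old ∈ ℝ^d and a real number 𝔸 with |𝔸| ≤ A_*, define ĝ(θ) := T γ^t · (∇_θ π_θ(a; s)/π_{θ_old}(a; s)) · 1[|π_θ(a; s)/π_{θ_old}(a; s) − 1| ≤ ε] · 𝔸 and write r(θ) := π_θ(a; s)/π_{θ_old}(a; s). Then for every θ ∈ ℝ^d, ‖ĝ(θ) − ĝ(θ_old)‖ ≤ T A_* L_s · ‖θ − θ_old‖ + T A_* Π_* · min(ε, |r(θ) − 1|) + T A_* Π_* · 1[|r(θ) − 1| > ε]. -/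
/-- Clipped per-transition PPO surrogate gradient contribution
`ĝ(θ) = T γ^t (∇_θ π_θ(a;s)/π_θold(a;s)) 1[|π_θ(a;s)/π_θold(a;s) - 1| ≤ ε] 𝔸`. -/
noncomputable def gHat {S A : Type*} [Fintype S] [Fintype A] {d : ℕ}
    (γ : ℝ) (T : ℕ) (ε : ℝ)
    (π : EuclideanSpace ℝ (Fin d) → S → A → ℝ)
    (θold : EuclideanSpace ℝ (Fin d)) (t : ℕ) (s : S) (a : A) (𝔸 : ℝ)
    (θ : EuclideanSpace ℝ (Fin d)) : EuclideanSpace ℝ (Fin d) :=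
  ((T : ℝ) * γ ^ t *
      (if |π θ s a / π θold s a - 1| ≤ ε then (1 : ℝ) else 0) * 𝔸 / π θold s a) •
    gradient (fun θ' => π θ' s a) θ

/-- **path-level bias decomposition.** With `r(θ) = π_θ(a;s)/π_θold(a;s)`,
`‖ĝ(θ) - ĝ(θold)‖ ≤ T A_* L_s ‖θ - θold‖ + T A_* Π_* min(ε, |r(θ)-1|)
  + T A_* Π_* 1[|r(θ)-1| > ε]`. -/
theorem path_level_bias_decomposition {S A : Type*} [Fintype S] [Fintype A]
    [Nonempty S] [Nonempty A] {d : ℕ}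
    (γ : ℝ) (hγ0 : 0 < γ) (hγ1 : γ < 1)
    (T : ℕ) (hT : 1 ≤ T)
    (π : EuclideanSpace ℝ (Fin d) → S → A → ℝ)
    (hπpos : ∀ θ s a, 0 < π θ s a)
    (hπ1 : ∀ θ s, ∑ a, π θ s a = 1)
    (hπdiff : ∀ s a, ContDiff ℝ 1 fun θ => π θ s a)
    (Pis : ℝ)
    (hscore : ∀ θ s a, ‖gradient (fun θ' => π θ' s a) θ‖ ≤ Pis * π θ s a)
    (Ls : ℝ)
    (hscoreLip : ∀ θ θ' : EuclideanSpace ℝ (Fin d), ∀ (s : S) (a : A),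
      ‖(π θ s a)⁻¹ • gradient (fun θ'' => π θ'' s a) θ
          - (π θ' s a)⁻¹ • gradient (fun θ'' => π θ'' s a) θ'‖ ≤ Ls * ‖θ - θ'‖)
    (ε : ℝ) (hε : 0 < ε)
    (As : ℝ) (hAs : 0 ≤ As)
    (t : ℕ) (ht : t < T) (s : S) (a : A)
    (θold : EuclideanSpace ℝ (Fin d))
    (𝔸 : ℝ) (h𝔸 : |𝔸| ≤ As)
    (θ : EuclideanSpace ℝ (Fin d)) :
    ‖gHat γ T ε π θold t s a 𝔸 θ - gHat γ T ε π θold t s a 𝔸 θold‖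
      ≤ (T : ℝ) * As * Ls * ‖θ - θold‖
        + (T : ℝ) * As * Pis * min ε |π θ s a / π θold s a - 1|
        + (T : ℝ) * As * Pis *
            (if ε < |π θ s a / π θold s a - 1| then (1 : ℝ) else 0) := by
  have hT0 : (0 : ℝ) ≤ T := T.cast_nonneg
  have hg (φ : EuclideanSpace ℝ (Fin d)) :
      ‖(π φ s a)⁻¹ • gradient (fun θ' => π θ' s a) φ‖ ≤ Pis := by
    rw [norm_smul, norm_inv, Real.norm_of_nonneg (hπpos φ s a).le,
      inv_mul_le_iff₀ (hπpos φ s a), mul_comm]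
    exact hscore φ s a
  have hPis : 0 ≤ Pis := (norm_nonneg _).trans (hg θ)
  have hL := hscoreLip θ θold s a
  have hL0 : 0 ≤ Ls * ‖θ - θold‖ := (norm_nonneg _).trans hL
  have hc : ‖(T : ℝ) * γ ^ t * 𝔸‖ ≤ T * As := by
    rw [norm_mul, norm_mul, Real.norm_of_nonneg hT0,
      Real.norm_of_nonneg (pow_nonneg hγ0.le t), Real.norm_eq_abs]
    exact mul_le_mul (mul_le_of_le_one_right hT0 (pow_le_one₀ hγ0.le hγ1.le)) h𝔸
      (abs_nonneg _) hT0
  have hTA : 0 ≤ (T : ℝ) * As := mul_nonneg hT0 hAs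
  have hp := (hπpos θ s a).ne'
  have hq := (hπpos θold s a).ne'
  have hgold : gHat γ T ε π θold t s a 𝔸 θold = ((T : ℝ) * γ ^ t * 𝔸) •
      ((π θold s a)⁻¹ • gradient (fun θ' => π θ' s a) θold) := by
    simp only [gHat, div_self hq, sub_self, abs_zero, hε.le, if_true, smul_smul]
    congr 1
    ring
  rw [hgold]
  by_cases hr : |π θ s a / π θold s a - 1| ≤ ε
  · have hgθ : gHat γ T ε π θold t s a 𝔸 θ = ((T : ℝ) * γ ^ t * 𝔸) •
        ((π θ s a / π θold s a) • ((π θ s a)⁻¹ • gradient (fun θ' => π θ' s a) θ)) := by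
      simp only [gHat, hr, if_true, smul_smul]
      congr 1
      field_simp
    rw [hgθ, if_neg hr.not_gt, min_eq_right hr, ← smul_sub, norm_smul]
    have hG := hg θ
    set r := π θ s a / π θold s a
    set u := (π θ s a)⁻¹ • gradient (fun θ' => π θ' s a) θ
    set v := (π θold s a)⁻¹ • gradient (fun θ' => π θ' s a) θold
    have key : ‖r • u - v‖ ≤ Ls * ‖θ - θold‖ + |r - 1| * Pis := by
      have hsplit : r • u - v = (u - v) + (r - 1) • u := by module
      rw [hsplit]
      refine (norm_add_le _ _).trans (add_le_add hL ?_)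
      rw [norm_smul, Real.norm_eq_abs]
      gcongr
    calc _ ≤ (T : ℝ) * As * (Ls * ‖θ - θold‖ + |r - 1| * Pis) :=
          mul_le_mul hc key (norm_nonneg _) hTA
      _ = _ := by ring
  · have hgθ : gHat γ T ε π θold t s a 𝔸 θ = 0 := by simp [gHat, hr]
    rw [hgθ, zero_sub, norm_neg, norm_smul, if_pos (not_le.mp hr)]
    have h₁ := mul_le_mul hc (hg θold) (norm_nonneg _) hTA
    have h₂ := mul_nonneg hTA hL0
    have h₃ : 0 ≤ (T : ℝ) * As * Pis * min ε |π θ s a / π θold s a - 1| := by positivity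
    linarith
end

section
/- For every t ∈ {0, …, T−1}, the fixed-time GAE estimator satisfies the TD-sum representation Â_t^T = Σ_{ℓ=0}^{T−t−1} (γλ)^ℓ · ((1 − λ^{T−t−ℓ})/(1 − λ^{T−t})) · δ_{t+ℓ}. Moreover, setting Â_T^T := 0, it satisfies the backward recursion Â_t^T = δ_t + γλ · ((1 − λ^{T−t−1})/(1 − λ^{T−t})) · Â_{t+1}^T for t = T−1, …, 0. -/
/-- The `k`-step advantage estimator `Â_t^{(k)} = ∑_{ℓ=0}^{k} γ^ℓ δ_{t+ℓ}`. -/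
noncomputable def kStepAdv (γ : ℝ) (δ : ℕ → ℝ) (t k : ℕ) : ℝ :=
  ∑ l ∈ Finset.range (k + 1), γ ^ l * δ (t + l)

/-- The fixed-time GAE estimator
`Â_t^T = ((1-λ)/(1-λ^{T-t})) ∑_{k=0}^{T-t-1} λ^k Â_t^{(k)}`
(equal to `0` at `t = T`). -/
noncomputable def fixedTimeGAE (γ lam : ℝ) (T : ℕ) (δ : ℕ → ℝ) (t : ℕ) : ℝ :=
  ((1 - lam) / (1 - lam ^ (T - t))) *
    ∑ k ∈ Finset.range (T - t), lam ^ k * kStepAdv γ δ t k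

/-- Summation by parts for geometrically weighted partial sums. -/
theorem one_sub_mul_sum_pow_mul_sum_range_succ {R : Type*} [CommRing R] (a : R) (f : ℕ → R)
    (n : ℕ) :
    (1 - a) * ∑ k ∈ Finset.range n, a ^ k * ∑ l ∈ Finset.range (k + 1), f l
      = ∑ l ∈ Finset.range n, (a ^ l - a ^ n) * f l := by
  induction n with
  | zero => simp
  | succ n ih =>
    have h : ∑ l ∈ Finset.range n, (a ^ l - a ^ (n + 1)) * f l
        = ∑ l ∈ Finset.range n, (a ^ l - a ^ n) * f l
          + (a ^ n - a ^ (n + 1)) * ∑ l ∈ Finset.range n, f l := by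
      rw [Finset.mul_sum, ← Finset.sum_add_distrib]
      exact Finset.sum_congr rfl fun l _ => by ring
    rw [Finset.sum_range_succ, mul_add, ih, Finset.sum_range_succ f, Finset.sum_range_succ, h]
    ring

theorem fixedTimeGAE_eq_sum (γ lam : ℝ) (T : ℕ) (δ : ℕ → ℝ) (t : ℕ) :
    fixedTimeGAE γ lam T δ t
      = ∑ l ∈ Finset.range (T - t),
          (γ * lam) ^ l * ((1 - lam ^ (T - t - l)) / (1 - lam ^ (T - t))) * δ (t + l) := by
  unfold fixedTimeGAE kStepAdv
  rw [div_mul_eq_mul_div, one_sub_mul_sum_pow_mul_sum_range_succ, Finset.sum_div]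
  refine Finset.sum_congr rfl fun l hl => ?_
  rw [← pow_mul_pow_sub lam (Finset.mem_range.mp hl).le]
  ring

theorem fixedTimeGAE_self (γ lam : ℝ) (T : ℕ) (δ : ℕ → ℝ) : fixedTimeGAE γ lam T δ T = 0 := by
  simp [fixedTimeGAE]

theorem fixedTimeGAE_eq_add_mul_succ (γ : ℝ) {lam : ℝ} (hl0 : 0 ≤ lam) (hl1 : lam < 1) {T : ℕ}
    (δ : ℕ → ℝ) {t : ℕ} (ht : t < T) :
    fixedTimeGAE γ lam T δ t
      = δ t + γ * lam * ((1 - lam ^ (T - t - 1)) / (1 - lam ^ (T - t)))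
          * fixedTimeGAE γ lam T δ (t + 1) := by
  have one_sub_pow_ne {n : ℕ} (hn : n ≠ 0) : 1 - lam ^ n ≠ 0 :=
    (sub_pos.mpr (pow_lt_one₀ hl0 hl1 hn)).ne'
  obtain ⟨m, rfl⟩ := Nat.exists_eq_add_of_lt ht
  have h1 : t + m + 1 - t = m + 1 := by omega
  have h2 : t + m + 1 - (t + 1) = m := by omega
  rw [fixedTimeGAE_eq_sum, fixedTimeGAE_eq_sum, h1, h2, Nat.add_sub_cancel,
    Finset.sum_range_succ', add_comm, Finset.mul_sum]
  congr 1
  · simp [div_self (one_sub_pow_ne m.succ_ne_zero)]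
  · refine Finset.sum_congr rfl fun l hl => ?_
    have hm := one_sub_pow_ne (Nat.ne_zero_of_lt (Finset.mem_range.mp hl))
    have hm' := one_sub_pow_ne m.succ_ne_zero
    rw [Nat.add_sub_add_right, ← add_assoc, add_right_comm t l 1]
    field_simp
    ring

/-- **fixed-time GAE: TD-sum representation and backward recursion.**
For every `t < T`:
`Â_t^T = ∑_{ℓ=0}^{T-t-1} (γλ)^ℓ ((1-λ^{T-t-ℓ})/(1-λ^{T-t})) δ_{t+ℓ}`, and (with
`Â_T^T = 0`) `Â_t^T = δ_t + γλ ((1-λ^{T-t-1})/(1-λ^{T-t})) Â_{t+1}^T`. -/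
theorem fixed_time_gae_recursion
    (γ lam : ℝ) (hγ0 : 0 < γ) (hγ1 : γ < 1) (hl0 : 0 < lam) (hl1 : lam < 1)
    (T : ℕ) (hT : 1 ≤ T) (δ : ℕ → ℝ) :
    (∀ t < T,
      fixedTimeGAE γ lam T δ t
        = ∑ l ∈ Finset.range (T - t),
            (γ * lam) ^ l * ((1 - lam ^ (T - t - l)) / (1 - lam ^ (T - t))) * δ (t + l))
    ∧ fixedTimeGAE γ lam T δ T = 0
    ∧ ∀ t < T,
        fixedTimeGAE γ lam T δ t
          = δ t + γ * lam * ((1 - lam ^ (T - t - 1)) / (1 - lam ^ (T - t)))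
              * fixedTimeGAE γ lam T δ (t + 1) := by
  exact ⟨fun t _ => fixedTimeGAE_eq_sum γ lam T δ t, fixedTimeGAE_self γ lam T δ,
    fun _ ht => fixedTimeGAE_eq_add_mul_succ γ hl0.le hl1 δ ht⟩
end
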